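/- Let T ∈ R(V). The decomposition of T with respect to u is unique: if T = S + ε (u ⊛ F) + Z ∧ η, where S ∈ R(V), F ∈ Λ^{(1,2)}(V) and Z is a symmetric (0,2)-tensor, and S, F, Z are all completely orthogonal to u, then necessarily S = T^{∥u}, F = T^{⊥∥} and Z = T^⊥. -/

import Mathlib

open scoped BigOperators

noncomputable section

namespace Decomp

abbrev Vec (n : ℕ) := Fin n → ℝ
abbrev Ten2 (n : ℕ) := Fin n → Fin n → ℝ
abbrev Ten3 (n : ℕ) := Fin n → Fin n → Fin n → ℝ
abbrev Ten4 (n : ℕ) := Fin n → Fin n → Fin n → Fin n → ℝ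

variable {n : ℕ}

/-- A (0,4)-tensor with the algebraic symmetries of a Riemann tensor. -/
def IsRiemannType (T : Ten4 n) : Prop :=
  (∀ α β μ ν, T α β μ ν = - T α β ν μ) ∧
  (∀ α β μ ν, T α β μ ν = - T β α μ ν) ∧
  (∀ α β μ ν, T α β μ ν = T μ ν α β) ∧
  (∀ α β μ ν, T α β μ ν + T α μ ν β + T α ν β μ = 0)

/-- A (0,3)-tensor antisymmetric in the last two indices with vanishing cyclic sum. -/
def IsLambda12 (F : Ten3 n) : Prop :=
  (∀ α μ ν, F α μ ν = - F α ν μ) ∧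
  (∀ α μ ν, F α μ ν + F μ ν α + F ν α μ = 0)

def IsSym2 (S : Ten2 n) : Prop := ∀ α β, S α β = S β α

/-- Ricci-type trace of a (0,4)-tensor (first and third indices, using the inverse metric). -/
def RicT (ginv : Ten2 n) (T : Ten4 n) : Ten2 n :=
  fun β ν => ∑ α, ∑ μ, ginv α μ * T α β μ ν

/-- Scalar-type trace. -/
def ScalT (ginv : Ten2 n) (T : Ten4 n) : ℝ :=
  ∑ β, ∑ ν, ginv β ν * RicT ginv T β ν

/-- Weyl-type: Riemann-type and trace-free in the first and third indices. -/
def IsWeylType (ginv : Ten2 n) (T : Ten4 n) : Prop :=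
  IsRiemannType T ∧ ∀ β ν, RicT ginv T β ν = 0

/-- Kulkarni–Nomizu product. -/
def KN (A B : Ten2 n) : Ten4 n := fun α β μ ν =>
  A α μ * B β ν - A α ν * B β μ - A β μ * B α ν + A β ν * B α μ

/-- (u ⊛ F) for a one-form w and F ∈ Λ^{(1,2)}. -/
def circ (w : Vec n) (F : Ten3 n) : Ten4 n := fun α β μ ν =>
  w α * F β μ ν - w β * F α μ ν + w μ * F ν α β - w ν * F μ α β

/-- Lower an index with the metric. -/
def lower (g : Ten2 n) (u : Vec n) : Vec n := fun α => ∑ β, g α β * u β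

/-- Projector orthogonal to `u`, both indices covariant: γ_{αβ} = g_{αβ} − ε u_α u_β. -/
def gam (g : Ten2 n) (ε : ℝ) (u : Vec n) : Ten2 n := fun α β =>
  g α β - ε * lower g u α * lower g u β

/-- Mixed projector γ^κ_μ = δ^κ_μ − ε u^κ u_μ. -/
def gamMix (g : Ten2 n) (ε : ℝ) (u : Vec n) : Ten2 n := fun κ μ =>
  (if κ = μ then (1 : ℝ) else 0) - ε * u κ * lower g u μ

/-- Contravariant projector γ^{αβ} = g^{αβ} − ε u^α u^β. -/
def gamUp (ginv : Ten2 n) (ε : ℝ) (u : Vec n) : Ten2 n := fun α β =>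
  ginv α β - ε * u α * u β

/-- η := u⊗u − (ε/(n−3)) γ. -/
def eta (g : Ten2 n) (ε : ℝ) (u : Vec n) : Ten2 n := fun α β =>
  lower g u α * lower g u β - (ε / ((n : ℝ) - 3)) * gam g ε u α β

/-- T^⊥_{βν} := u^α u^μ T_{αβμν}. -/
def perp (u : Vec n) (T : Ten4 n) : Ten2 n := fun β ν =>
  ∑ α, ∑ μ, u α * u μ * T α β μ ν

/-- T^{⊥∥}_{βμν} := u^α γ^κ_μ γ^σ_ν T_{αβκσ}. -/
def perppar (g : Ten2 n) (ε : ℝ) (u : Vec n) (T : Ten4 n) : Ten3 n := fun β μ ν =>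
  ∑ α, ∑ κ, ∑ σ, u α * gamMix g ε u κ μ * gamMix g ε u σ ν * T α β κ σ

/-- T^∥ : projection of T with γ in all four indices. -/
def par4 (g : Ten2 n) (ε : ℝ) (u : Vec n) (T : Ten4 n) : Ten4 n := fun α β μ ν =>
  ∑ ρ, ∑ σ, ∑ κ, ∑ δ,
    gamMix g ε u ρ α * gamMix g ε u σ β * gamMix g ε u κ μ * gamMix g ε u δ ν * T ρ σ κ δ

/-- T^{∥u} := T^∥ + (ε/(n−3)) T^⊥ ∧ γ. -/
def parU (g : Ten2 n) (ε : ℝ) (u : Vec n) (T : Ten4 n) : Ten4 n := fun α β μ ν =>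
  par4 g ε u T α β μ ν + (ε / ((n : ℝ) - 3)) * KN (perp u T) (gam g ε u) α β μ ν

/-- Complete orthogonality to `u` for (0,2)-tensors. -/
def Orth2 (u : Vec n) (S : Ten2 n) : Prop :=
  (∀ β, (∑ α, u α * S α β) = 0) ∧ (∀ β, (∑ α, u α * S β α) = 0)

/-- Complete orthogonality to `u` for (0,3)-tensors. -/
def Orth3 (u : Vec n) (F : Ten3 n) : Prop :=
  (∀ μ ν, (∑ α, u α * F α μ ν) = 0) ∧ (∀ μ ν, (∑ α, u α * F μ α ν) = 0) ∧
    (∀ μ ν, (∑ α, u α * F μ ν α) = 0)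

/-- Complete orthogonality to `u` for (0,4)-tensors. -/
def Orth4 (u : Vec n) (T : Ten4 n) : Prop :=
  (∀ β μ ν, (∑ α, u α * T α β μ ν) = 0) ∧ (∀ β μ ν, (∑ α, u α * T β α μ ν) = 0) ∧
    (∀ β μ ν, (∑ α, u α * T β μ α ν) = 0) ∧ (∀ β μ ν, (∑ α, u α * T β μ ν α) = 0)

/-- tr_γ of a (0,2)-tensor. -/
def trGam (ginv : Ten2 n) (ε : ℝ) (u : Vec n) (S : Ten2 n) : ℝ :=
  ∑ α, ∑ β, gamUp ginv ε u α β * S α β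

/-- Schouten-type tensor of a (0,4)-tensor. -/
def SchT (g ginv : Ten2 n) (T : Ten4 n) : Ten2 n := fun β ν =>
  (1 / ((n : ℝ) - 2)) * (RicT ginv T β ν - ScalT ginv T / (2 * ((n : ℝ) - 1)) * g β ν)

/-- Weyl-type part of a (0,4)-tensor: Weyl(T) := T − Sch(T) ∧ g. -/
def WeylT (g ginv : Ten2 n) (T : Ten4 n) : Ten4 n := fun α β μ ν =>
  T α β μ ν - KN (SchT g ginv T) g α β μ ν

/-- Sch_u for Riemann-type tensors completely orthogonal to u. -/
def SchU (g ginv : Ten2 n) (ε : ℝ) (u : Vec n) (P : Ten4 n) : Ten2 n := fun β ν =>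
  (1 / ((n : ℝ) - 3)) * (RicT ginv P β ν - ScalT ginv P / (2 * ((n : ℝ) - 2)) * gam g ε u β ν)

/-- Weyl_u for Riemann-type tensors completely orthogonal to u. -/
def WeylU (g ginv : Ten2 n) (ε : ℝ) (u : Vec n) (P : Ten4 n) : Ten4 n := fun α β μ ν =>
  P α β μ ν - KN (SchU g ginv ε u P) (gam g ε u) α β μ ν

/-- Z_tr := tr_γ T^⊥. -/
def Ztr (ginv : Ten2 n) (ε : ℝ) (u : Vec n) (T : Ten4 n) : ℝ :=
  trGam ginv ε u (perp u T)

/-- γ-trace-free part of an orthogonal symmetric (0,2)-tensor. -/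
def hat2 (g ginv : Ten2 n) (ε : ℝ) (u : Vec n) (S : Ten2 n) : Ten2 n := fun β ν =>
  S β ν - trGam ginv ε u S / ((n : ℝ) - 1) * gam g ε u β ν

/-- T̂^⊥ := T^⊥ − (Z_tr/(n−1)) γ. -/
def hatPerp (g ginv : Ten2 n) (ε : ℝ) (u : Vec n) (T : Ten4 n) : Ten2 n :=
  hat2 g ginv ε u (perp u T)

/-- (V_tr)_μ := γ^{αβ} T^{⊥∥}_{αβμ}. -/
def Vtr (g ginv : Ten2 n) (ε : ℝ) (u : Vec n) (T : Ten4 n) : Vec n := fun μ =>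
  ∑ α, ∑ β, gamUp ginv ε u α β * perppar g ε u T α β μ

/-- T̂^{⊥∥}_{αβμ} := T^{⊥∥}_{αβμ} + (1/(n−2))(−γ_{αβ}(V_tr)_μ + γ_{αμ}(V_tr)_β). -/
def hatPerppar (g ginv : Ten2 n) (ε : ℝ) (u : Vec n) (T : Ten4 n) : Ten3 n := fun α β μ =>
  perppar g ε u T α β μ + (1 / ((n : ℝ) - 2)) *
    (- gam g ε u α β * Vtr g ginv ε u T μ + gam g ε u α μ * Vtr g ginv ε u T β)

/-- S^∥_{βν} := γ^ρ_β γ^κ_ν S_{ρκ}. -/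
def s2par (g : Ten2 n) (ε : ℝ) (u : Vec n) (S : Ten2 n) : Ten2 n := fun β ν =>
  ∑ ρ, ∑ κ, gamMix g ε u ρ β * gamMix g ε u κ ν * S ρ κ

/-- S^{⊥∥}_β := γ^ρ_β u^κ S_{ρκ}. -/
def s2perppar (g : Ten2 n) (ε : ℝ) (u : Vec n) (S : Ten2 n) : Vec n := fun β =>
  ∑ ρ, ∑ κ, gamMix g ε u ρ β * u κ * S ρ κ

/-- S^⊥ := u^ρ u^κ S_{ρκ}. -/
def s2perp (u : Vec n) (S : Ten2 n) : ℝ := ∑ ρ, ∑ κ, u ρ * u κ * S ρ κ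

/-- σ^{(2)}_{βν} := σ_{βρ} σ^ρ{}_ν. -/
def sq (ginv : Ten2 n) (σ : Ten2 n) : Ten2 n := fun β ν =>
  ∑ ρ, ∑ κ, σ β ρ * ginv ρ κ * σ κ ν

/-- Mixed projector h^μ_{μ'} = γ^μ_{μ'} + ε y^μ y_{μ'} orthogonal to span{u,y}. -/
def hMix (g : Ten2 n) (ε : ℝ) (u y : Vec n) : Ten2 n := fun μ μ' =>
  gamMix g ε u μ μ' + ε * y μ * lower g y μ'

/-- Covariant projector h_{αβ} = γ_{αβ} + ε y_α y_β. -/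
def hCov (g : Ten2 n) (ε : ℝ) (u y : Vec n) : Ten2 n := fun α β =>
  gam g ε u α β + ε * lower g y α * lower g y β

/-- g is a symmetric nondegenerate bilinear form with (symmetric) inverse ginv. -/
def GoodMetric (g ginv : Ten2 n) : Prop :=
  (∀ α β, g α β = g β α) ∧ (∀ α β, ginv α β = ginv β α) ∧
    (∀ α β, (∑ μ, ginv α μ * g μ β) = if α = β then (1 : ℝ) else 0) ∧
    (∀ α β, (∑ μ, g α μ * ginv μ β) = if α = β then (1 : ℝ) else 0)

/-- u is a unit vector with g(u,u) = ε ∈ {−1,1}. -/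
def UnitVec (g : Ten2 n) (ε : ℝ) (u : Vec n) : Prop :=
  (ε = 1 ∨ ε = -1) ∧ (∑ α, ∑ β, g α β * u α * u β) = ε


theorem sum_gamMix_mul (g : Ten2 n) (ε : ℝ) (u x : Vec n) (μ : Fin n) :
    ∑ κ, gamMix g ε u κ μ * x κ = x μ - ε * lower g u μ * ∑ κ, u κ * x κ := by
  have h : ∑ κ, gamMix g ε u κ μ * x κ
      = ∑ κ, (if κ = μ then x κ else 0) - ε * lower g u μ * ∑ κ, u κ * x κ := by
    rw [Finset.mul_sum, ← Finset.sum_sub_distrib]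
    refine Finset.sum_congr rfl fun κ _ => ?_
    unfold gamMix
    split_ifs <;> ring
  rw [h]
  simp

theorem perppar_eq_iterated (g : Ten2 n) (ε : ℝ) (u : Vec n) (T : Ten4 n) (β μ ν : Fin n) :
    perppar g ε u T β μ ν
      = ∑ σ, gamMix g ε u σ ν * ∑ κ, gamMix g ε u κ μ * ∑ α, u α * T α β κ σ := by
  simp only [perppar, Finset.mul_sum]
  rw [Finset.sum_comm_cycle, Finset.sum_congr rfl fun _ _ => Finset.sum_comm]
  refine Finset.sum_congr rfl fun _ _ => Finset.sum_congr rfl fun _ _ =>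
    Finset.sum_congr rfl fun _ _ => by ring

theorem par4_eq_iterated (g : Ten2 n) (ε : ℝ) (u : Vec n) (T : Ten4 n) (α β μ ν : Fin n) :
    par4 g ε u T α β μ ν
      = ∑ ρ, gamMix g ε u ρ α * ∑ σ, gamMix g ε u σ β * ∑ κ, gamMix g ε u κ μ *
          ∑ δ, gamMix g ε u δ ν * T ρ σ κ δ := by
  simp only [par4, Finset.mul_sum, mul_assoc]

theorem perp_eq_iterated (u : Vec n) (T : Ten4 n) (β ν : Fin n) :
    perp u T β ν = ∑ μ, u μ * ∑ α, u α * T α β μ ν := by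
  simp only [perp, Finset.mul_sum]
  rw [Finset.sum_comm]
  refine Finset.sum_congr rfl fun _ _ => Finset.sum_congr rfl fun _ _ => by ring

theorem UnitVec.sq_eq_one {g : Ten2 n} {ε : ℝ} {u : Vec n} (hu : UnitVec g ε u) :
    ε * ε = 1 := by
  rcases hu.1 with h | h <;> norm_num [h]

theorem UnitVec.sum_mul_lower {g : Ten2 n} {ε : ℝ} {u : Vec n} (hu : UnitVec g ε u) :
    ∑ α, u α * lower g u α = ε := by
  rw [← hu.2]
  simp only [lower, Finset.mul_sum]
  refine Finset.sum_congr rfl fun _ _ => Finset.sum_congr rfl fun _ _ => by ring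

theorem UnitVec.sum_mul_gam_right {g : Ten2 n} {ε : ℝ} {u : Vec n} (hu : UnitVec g ε u)
    (β : Fin n) : ∑ α, u α * gam g ε u β α = 0 := by
  have h : ∑ α, u α * gam g ε u β α
      = lower g u β - ε * lower g u β * ∑ α, u α * lower g u α := by
    rw [Finset.mul_sum, lower, ← Finset.sum_sub_distrib]
    refine Finset.sum_congr rfl fun _ _ => ?_
    simp only [gam, lower]
    ring
  rw [h, hu.sum_mul_lower]
  linear_combination -lower g u β * hu.sq_eq_one

theorem gam_symm {g : Ten2 n} (hg : ∀ α β, g α β = g β α) (ε : ℝ) (u : Vec n) (α β : Fin n) :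
    gam g ε u α β = gam g ε u β α := by
  simp only [gam, hg α β]
  ring

theorem UnitVec.sum_mul_gam_left {g : Ten2 n} {ε : ℝ} {u : Vec n} (hu : UnitVec g ε u)
    (hg : ∀ α β, g α β = g β α) (β : Fin n) : ∑ α, u α * gam g ε u α β = 0 := by
  simpa only [gam_symm hg ε u β] using hu.sum_mul_gam_right β

/-- Lemma `decom1`, uniqueness part: the decomposition of a Riemann-type
tensor with respect to `u` is unique. -/
theorem stmt1 {n : ℕ} (hn : 4 ≤ n) (g ginv : Ten2 n) (hg : GoodMetric g ginv)
    (ε : ℝ) (u : Vec n) (hu : UnitVec g ε u)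
    (T : Ten4 n) (hT : IsRiemannType T)
    (S : Ten4 n) (F : Ten3 n) (Z : Ten2 n)
    (hS : IsRiemannType S) (hSo : Orth4 u S)
    (hF : IsLambda12 F) (hFo : Orth3 u F)
    (hZ : IsSym2 Z) (hZo : Orth2 u Z)
    (hdec : ∀ α β μ ν, T α β μ ν = S α β μ ν + ε * circ (lower g u) F α β μ ν
      + KN Z (eta g ε u) α β μ ν) :
    S = parU g ε u T ∧ F = perppar g ε u T ∧ Z = perp u T := by
  obtain ⟨hZ₁, hZ₂⟩ := hZo
  obtain ⟨hF₁, hF₂, hF₃⟩ := hFo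
  obtain ⟨hS₁, hS₂, hS₃, hS₄⟩ := hSo
  have hε := hu.sq_eq_one
  have hw := hu.sum_mul_lower
  have hγ₁ := hu.sum_mul_gam_left hg.1
  have hγ₂ := hu.sum_mul_gam_right
  have hcontr : ∀ β μ ν, ∑ α, u α * T α β μ ν
      = F β μ ν + ε * (Z β ν * lower g u μ - Z β μ * lower g u ν) := by
    intro β μ ν
    set w := lower g u with hwdef
    set c := ε / ((n : ℝ) - 3) with hc
    have h : ∑ α, u α * T α β μ ν
        = ∑ α, u α * S α β μ ν
          + ε * ((∑ α, u α * w α) * F β μ ν - w β * ∑ α, u α * F α μ ν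
            + w μ * ∑ α, u α * F ν α β - w ν * ∑ α, u α * F μ α β)
          + (eta g ε u β ν * ∑ α, u α * Z α μ - eta g ε u β μ * ∑ α, u α * Z α ν
            - Z β μ * ((∑ α, u α * w α) * w ν - c * ∑ α, u α * gam g ε u α ν)
            + Z β ν * ((∑ α, u α * w α) * w μ - c * ∑ α, u α * gam g ε u α μ)) := by
      simp only [Finset.mul_sum, Finset.sum_mul, ← Finset.sum_add_distrib,
        ← Finset.sum_sub_distrib]
      refine Finset.sum_congr rfl fun α _ => ?_
      rw [hdec]
      simp only [circ, KN, eta, ← hwdef, ← hc]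
      ring
    rw [h, hS₁, hw, hF₁, hF₂, hF₂, hZ₁, hZ₁, hγ₁, hγ₁]
    linear_combination F β μ ν * hε
  have hperp : Z = perp u T := by
    funext β ν
    have h : ∑ μ, u μ * (F β μ ν + ε * (Z β ν * lower g u μ - Z β μ * lower g u ν))
        = ∑ μ, u μ * F β μ ν + ε * (Z β ν * (∑ μ, u μ * lower g u μ)
          - (∑ μ, u μ * Z β μ) * lower g u ν) := by
      simp only [Finset.mul_sum, Finset.sum_mul, ← Finset.sum_add_distrib,
        ← Finset.sum_sub_distrib]
      exact Finset.sum_congr rfl fun _ _ => by ring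
    simp only [perp_eq_iterated, hcontr]
    rw [h, hF₂, hw, hZ₂]
    linear_combination -Z β ν * hε
  refine ⟨?_, ?_, hperp⟩
  · funext α β μ ν
    rw [parU, ← hperp, par4_eq_iterated]
    simp only [KN]
    set w := lower g u with hwdef
    set γ := gam g ε u with hγdef
    set c := ε / ((n : ℝ) - 3) with hc
    have proj₄ : ∀ ρ σ κ, ∑ δ, gamMix g ε u δ ν * T ρ σ κ δ
        = S ρ σ κ ν + ε * (w ρ * F σ κ ν - w σ * F ρ κ ν + w κ * F ν ρ σ)
          + (- c * Z ρ κ * γ σ ν - Z ρ ν * (w σ * w κ - c * γ σ κ)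
            + c * Z σ κ * γ ρ ν + Z σ ν * (w ρ * w κ - c * γ ρ κ)) := by
      intro ρ σ κ
      have h : ∑ δ, u δ * T ρ σ κ δ
          = ∑ δ, u δ * S ρ σ κ δ
            + ε * (w ρ * ∑ δ, u δ * F σ κ δ - w σ * ∑ δ, u δ * F ρ κ δ
              + w κ * ∑ δ, u δ * F δ ρ σ - (∑ δ, u δ * w δ) * F κ ρ σ)
            + (Z ρ κ * (w σ * (∑ δ, u δ * w δ) - c * ∑ δ, u δ * γ σ δ)
              - eta g ε u σ κ * ∑ δ, u δ * Z ρ δ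
              - Z σ κ * (w ρ * (∑ δ, u δ * w δ) - c * ∑ δ, u δ * γ ρ δ)
              + eta g ε u ρ κ * ∑ δ, u δ * Z σ δ) := by
        simp only [Finset.mul_sum, Finset.sum_mul, ← Finset.sum_add_distrib,
          ← Finset.sum_sub_distrib]
        refine Finset.sum_congr rfl fun δ _ => ?_
        rw [hdec]
        simp only [circ, KN, eta, ← hwdef, ← hc, ← hγdef]
        ring
      rw [sum_gamMix_mul, h, hS₄, hF₃, hF₃, hF₁, hw, hγ₂, hγ₂, hZ₂, hZ₂, hdec]
      simp only [circ, KN, eta, ← hwdef, ← hc, ← hγdef]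
      linear_combination (ε * w ν * F κ ρ σ - Z ρ κ * w σ * w ν + Z σ κ * w ρ * w ν) * hε
    have proj₃ : ∀ ρ σ, ∑ κ, gamMix g ε u κ μ * ∑ δ, gamMix g ε u δ ν * T ρ σ κ δ
        = S ρ σ μ ν + ε * (w ρ * F σ μ ν - w σ * F ρ μ ν)
          + c * (- Z ρ μ * γ σ ν + Z ρ ν * γ σ μ + Z σ μ * γ ρ ν - Z σ ν * γ ρ μ) := by
      intro ρ σ
      have h : ∑ κ, u κ * (S ρ σ κ ν + ε * (w ρ * F σ κ ν - w σ * F ρ κ ν + w κ * F ν ρ σ)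
          + (- c * Z ρ κ * γ σ ν - Z ρ ν * (w σ * w κ - c * γ σ κ)
            + c * Z σ κ * γ ρ ν + Z σ ν * (w ρ * w κ - c * γ ρ κ)))
          = ∑ κ, u κ * S ρ σ κ ν
            + ε * (w ρ * ∑ κ, u κ * F σ κ ν - w σ * ∑ κ, u κ * F ρ κ ν
              + (∑ κ, u κ * w κ) * F ν ρ σ)
            + ((- c * γ σ ν) * ∑ κ, u κ * Z ρ κ
              - Z ρ ν * (w σ * (∑ κ, u κ * w κ) - c * ∑ κ, u κ * γ σ κ)
              + c * γ ρ ν * ∑ κ, u κ * Z σ κ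
              + Z σ ν * (w ρ * (∑ κ, u κ * w κ) - c * ∑ κ, u κ * γ ρ κ)) := by
        simp only [Finset.mul_sum, Finset.sum_mul, ← Finset.sum_add_distrib,
          ← Finset.sum_sub_distrib]
        exact Finset.sum_congr rfl fun _ _ => by ring
      simp only [proj₄]
      rw [sum_gamMix_mul, h, hS₃, hF₂, hF₂, hw, hγ₂, hγ₂, hZ₂, hZ₂, ← hwdef]
      linear_combination (- ε * w μ * F ν ρ σ + Z ρ ν * w σ * w μ - Z σ ν * w ρ * w μ) * hε
    have proj₂ : ∀ ρ, ∑ σ, gamMix g ε u σ β * ∑ κ, gamMix g ε u κ μ *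
          ∑ δ, gamMix g ε u δ ν * T ρ σ κ δ
        = S ρ β μ ν + ε * (w ρ * F β μ ν)
          + c * (- Z ρ μ * γ β ν + Z ρ ν * γ β μ + Z β μ * γ ρ ν - Z β ν * γ ρ μ) := by
      intro ρ
      have h : ∑ σ, u σ * (S ρ σ μ ν + ε * (w ρ * F σ μ ν - w σ * F ρ μ ν)
          + c * (- Z ρ μ * γ σ ν + Z ρ ν * γ σ μ + Z σ μ * γ ρ ν - Z σ ν * γ ρ μ))
          = ∑ σ, u σ * S ρ σ μ ν
            + ε * (w ρ * ∑ σ, u σ * F σ μ ν - (∑ σ, u σ * w σ) * F ρ μ ν)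
            + c * (- Z ρ μ * (∑ σ, u σ * γ σ ν) + Z ρ ν * (∑ σ, u σ * γ σ μ)
              + (∑ σ, u σ * Z σ μ) * γ ρ ν - (∑ σ, u σ * Z σ ν) * γ ρ μ) := by
        simp only [Finset.mul_sum, Finset.sum_mul, ← Finset.sum_add_distrib,
          ← Finset.sum_sub_distrib]
        exact Finset.sum_congr rfl fun _ _ => by ring
      simp only [proj₃]
      rw [sum_gamMix_mul, h, hS₂, hF₁, hw, hγ₁, hγ₁, hZ₁, hZ₁, ← hwdef]
      linear_combination ε * w β * F ρ μ ν * hε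
    have h : ∑ ρ, u ρ * (S ρ β μ ν + ε * (w ρ * F β μ ν)
          + c * (- Z ρ μ * γ β ν + Z ρ ν * γ β μ + Z β μ * γ ρ ν - Z β ν * γ ρ μ))
        = ∑ ρ, u ρ * S ρ β μ ν + ε * ((∑ ρ, u ρ * w ρ) * F β μ ν)
          + c * (- (∑ ρ, u ρ * Z ρ μ) * γ β ν + (∑ ρ, u ρ * Z ρ ν) * γ β μ
            + Z β μ * (∑ ρ, u ρ * γ ρ ν) - Z β ν * (∑ ρ, u ρ * γ ρ μ)) := by
      simp only [← Finset.sum_neg_distrib, Finset.mul_sum, Finset.sum_mul,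
        ← Finset.sum_add_distrib, ← Finset.sum_sub_distrib]
      exact Finset.sum_congr rfl fun _ _ => by ring
    simp only [proj₂]
    rw [sum_gamMix_mul, h, hS₁, hw, hγ₁, hγ₁, hZ₁, hZ₁, ← hwdef]
    linear_combination ε * w α * F β μ ν * hε
  · funext β μ ν
    have hinner : ∀ σ, ∑ κ, gamMix g ε u κ μ * (F β κ σ
          + ε * (Z β σ * lower g u κ - Z β κ * lower g u σ))
        = F β μ σ - ε * Z β μ * lower g u σ := by
      intro σ
      have h : ∑ κ, u κ * (F β κ σ + ε * (Z β σ * lower g u κ - Z β κ * lower g u σ))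
          = ∑ κ, u κ * F β κ σ + ε * (Z β σ * (∑ κ, u κ * lower g u κ)
            - (∑ κ, u κ * Z β κ) * lower g u σ) := by
        simp only [Finset.mul_sum, Finset.sum_mul, ← Finset.sum_add_distrib,
          ← Finset.sum_sub_distrib]
        exact Finset.sum_congr rfl fun _ _ => by ring
      rw [sum_gamMix_mul, h, hF₂, hw, hZ₂]
      linear_combination - ε * Z β σ * lower g u μ * hε
    have h : ∑ σ, u σ * (F β μ σ - ε * Z β μ * lower g u σ)
        = ∑ σ, u σ * F β μ σ - ε * Z β μ * ∑ σ, u σ * lower g u σ := by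
      simp only [Finset.mul_sum, ← Finset.sum_sub_distrib]
      exact Finset.sum_congr rfl fun _ _ => by ring
    simp only [perppar_eq_iterated, hcontr, hinner]
    rw [sum_gamMix_mul, h, hF₃, hw]
    linear_combination - ε * Z β μ * lower g u ν * hε


end Decomp
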